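/- Let A be a copositive (n+k+1)×(n+k+1) matrix of the form [[A₁, b₁, 0],[b₁^T, c, b₂^T],[0, b₂, A₂]] such that the overlapping blocks [[A₁, b₁],[b₁^T, c]] and [[c, b₂^T],[b₂, A₂]] have off-diagonal entries nondecreasing in rows and columns. Then A is SPN. -/

import Mathlib

open Matrix

def Copositive {ι : Type*} [Fintype ι] (A : Matrix ι ι ℝ) : Prop :=
  ∀ x : ι → ℝ, (∀ i, 0 ≤ x i) → 0 ≤ x ⬝ᵥ A.mulVec x

def SPN {ι : Type*} [Fintype ι] (A : Matrix ι ι ℝ) : Prop :=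
  ∃ P N : Matrix ι ι ℝ, P.PosSemidef ∧ (∀ i j, 0 ≤ N i j) ∧ A = P + N

def Mn {n : ℕ} (A : Matrix (Fin n) (Fin n) ℝ) : Prop :=
  ∀ i j k l : Fin n, i ≤ k → j ≤ l → i ≠ j → k ≠ l → A i j ≤ A k l


section helpers
variable {ι : Type*} [Fintype ι]

lemma quad_eq (A : Matrix ι ι ℝ) (x : ι → ℝ) :
    x ⬝ᵥ A.mulVec x = ∑ i, ∑ j, x i * A i j * x j := by
  simp only [dotProduct, mulVec, Finset.mul_sum, mul_assoc]

lemma SPN.add' {A B : Matrix ι ι ℝ} (hA : SPN A) (hB : SPN B) : SPN (A + B) := by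
  obtain ⟨P, N, hP, hN, rfl⟩ := hA
  obtain ⟨P', N', hP', hN', rfl⟩ := hB
  refine ⟨P + P', N + N', hP.add hP', fun i j => add_nonneg (hN i j) (hN' i j), ?_⟩
  abel

lemma SPN.of_nonneg {A : Matrix ι ι ℝ} (hA : ∀ i j, 0 ≤ A i j) : SPN A :=
  ⟨0, A, Matrix.PosSemidef.zero, hA, by simp⟩

lemma SPN.of_psd {A : Matrix ι ι ℝ} (hA : A.PosSemidef) : SPN A :=
  ⟨A, 0, hA, by simp, by simp⟩

/-- Effect on the quadratic form of a change in one coordinate. -/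
lemma quad_add_single [DecidableEq ι] (A : Matrix ι ι ℝ) (hs : A.IsSymm) (x : ι → ℝ) (a : ι)
    (t : ℝ) :
    (x + Pi.single a t) ⬝ᵥ A.mulVec (x + Pi.single a t)
      = x ⬝ᵥ A.mulVec x + 2 * t * (A.mulVec x) a + t ^ 2 * A a a := by
  have h1 : x ⬝ᵥ A.mulVec (Pi.single a t) = t * (A.mulVec x) a := by
    rw [dotProduct_mulVec, dotProduct_single, ← mulVec_transpose, hs.eq, mul_comm]
  rw [mulVec_add, add_dotProduct, dotProduct_add, dotProduct_add, h1, single_dotProduct,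
    single_dotProduct]
  simp [mulVec_single]
  ring

lemma Copositive.diag_nonneg [DecidableEq ι] {A : Matrix ι ι ℝ} (h : Copositive A) (a : ι) :
    0 ≤ A a a := by
  have := h (Pi.single a 1) (by intro i; by_cases hi : i = a <;> simp [Pi.single_apply, hi])
  simpa [mulVec_single] using this

/-- A copositive matrix with a negative entry in row `a` has positive diagonal entry there. -/
lemma Copositive.diag_pos [DecidableEq ι] {A : Matrix ι ι ℝ} (h : Copositive A)
    (hs : A.IsSymm) {a z : ι} (haz : A a z < 0) : 0 < A a a := by
  rcases (h.diag_nonneg a).lt_or_eq with h0 | h0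
  · exact h0
  exfalso
  have hzz := h.diag_nonneg z
  set t : ℝ := (A z z + 1) / (-A a z) with ht
  have htp : 0 ≤ t := by
    apply div_nonneg <;> linarith
  have hm : t * A a z = -(A z z + 1) := by
    have hne : A a z ≠ 0 := haz.ne
    rw [ht, div_neg, neg_mul, div_mul_cancel₀ _ hne]
  have hq := h (Pi.single z 1 + Pi.single a t) (by
    intro i
    simp only [Pi.add_apply, Pi.single_apply]
    split_ifs <;> linarith)
  rw [quad_add_single A hs] at hq
  simp [mulVec_single] at hq
  nlinarith

end helpers

lemma main_aux {ι : Type*} [Fintype ι] [LinearOrder ι] (m : ℕ) :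
    ∀ (s : Finset ι) (A : Matrix ι ι ℝ), s.card = m → A.IsSymm →
      (∀ i j, i ∉ s → A i j = 0) →
      (∀ i ∈ s, ∀ j ∈ s, ∀ k ∈ s, ∀ l ∈ s, i ≤ k → j ≤ l → i ≠ j → k ≠ l → A i j ≤ A k l) →
      Copositive A → SPN A := by
  induction m with
  | zero =>
    intro s A hc hs h0 hm hcop
    rw [Finset.card_eq_zero] at hc
    subst hc
    exact SPN.of_nonneg fun i j => (h0 i j (by simp)).ge
  | succ m ih =>
    intro s A hc hs h0 hm hcop
    have hne : s.Nonempty := Finset.card_pos.mp (by omega)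
    have hsym : ∀ i j, A i j = A j i := fun i j => hs.apply j i
    have h0' : ∀ i j, j ∉ s → A i j = 0 := fun i j hj => by rw [hsym]; exact h0 j i hj
    obtain ⟨a, ha⟩ : ∃ a, a = s.min' hne := ⟨_, rfl⟩
    obtain ⟨z, hz⟩ : ∃ z, z = s.max' hne := ⟨_, rfl⟩
    have has : a ∈ s := ha ▸ s.min'_mem hne
    have hzs : z ∈ s := hz ▸ s.max'_mem hne
    have hale : ∀ i ∈ s, a ≤ i := fun i hi => ha ▸ s.min'_le i hi
    have hlez : ∀ i ∈ s, i ≤ z := fun i hi => hz ▸ s.le_max' i hi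
    by_cases hcase : a = z ∨ 0 ≤ A a z
    · -- the last row is nonnegative
      have hrow : ∀ i, 0 ≤ A i z := by
        intro i
        by_cases hi : i ∈ s
        · by_cases hiz : i = z
          · subst hiz; exact hcop.diag_nonneg i
          · have haz : a ≠ z := by
              intro h
              exact hiz (le_antisymm (hlez i hi) (h ▸ hale i hi))
            have := hcase.resolve_left haz
            exact this.trans (hm a has z hzs i hi z hzs (hale i hi) le_rfl haz hiz)
        · rw [h0 i z hi]
      set A' : Matrix ι ι ℝ := Matrix.of fun i j => if i = z ∨ j = z then 0 else A i j with hA'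
      set N : Matrix ι ι ℝ := Matrix.of fun i j => if i = z ∨ j = z then A i j else 0 with hN
      have hsum : A = A' + N := by
        ext i j
        simp only [hA', hN, Matrix.add_apply, Matrix.of_apply]
        split_ifs <;> simp
      have hNn : SPN N := by
        apply SPN.of_nonneg
        intro i j
        simp only [hN, Matrix.of_apply]
        split_ifs with h
        · rcases h with h | h
          · subst h; rw [hsym]; exact hrow j
          · subst h; exact hrow i
        · exact le_rfl
      have hA'n : SPN A' := by
        refine ih (s.erase z) A' (by rw [Finset.card_erase_of_mem hzs]; omega) ?_ ?_ ?_ ?_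
        · ext i j
          simp only [hA', Matrix.transpose_apply, Matrix.of_apply, hsym j i, or_comm]
        · intro i j hi
          simp only [hA', Matrix.of_apply]
          split_ifs with h
          · rfl
          · apply h0
            intro his
            exact hi (Finset.mem_erase.mpr ⟨fun e => h (Or.inl e), his⟩)
        · intro i hi j hj k hk l hl hik hjl hij hkl
          rw [Finset.mem_erase] at hi hj hk hl
          simp only [hA', Matrix.of_apply, hi.1, hj.1, hk.1, hl.1, or_self, if_false]
          exact hm i hi.2 j hj.2 k hk.2 l hl.2 hik hjl hij hkl
        · intro x hx
          have := hcop (fun i => if i = z then 0 else x i) (by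
            intro i; split_ifs; exacts [le_rfl, hx i])
          rw [quad_eq] at this ⊢
          refine this.trans_eq (Finset.sum_congr rfl fun i _ => Finset.sum_congr rfl fun j _ => ?_)
          simp only [hA', Matrix.of_apply]
          by_cases h1 : i = z <;> by_cases h2 : j = z <;> simp [h1, h2]
      rw [hsum]
      exact hA'n.add' hNn
    · -- Schur complement with respect to the first row
      push Not at hcase
      obtain ⟨haz, hneg⟩ := hcase
      have hpos := hcop.diag_pos hs hneg
      have hrow : ∀ i ∈ s, i ≠ a → A a i < 0 := fun i hi hia =>
        (hm a has i hi a has z hzs le_rfl (hlez i hi) (Ne.symm hia) haz).trans_lt hneg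
      set R : Matrix ι ι ℝ := Matrix.of fun i j => A a i * A a j / A a a with hR
      have hRp : R.PosSemidef := by
        have h1 := (Matrix.posSemidef_vecMulVec_self_star (A a)).smul (inv_nonneg.mpr hpos.le)
        convert h1 using 1
        ext i j
        simp [hR, vecMulVec_apply]
        ring
      have hA'n : SPN (A - R) := by
        refine ih (s.erase a) (A - R) (by rw [Finset.card_erase_of_mem has]; omega) ?_ ?_ ?_ ?_
        · ext i j
          simp only [hR, Matrix.transpose_apply, Matrix.sub_apply, Matrix.of_apply, hsym j i]
          ring
        · intro i j hi
          simp only [hR, Matrix.sub_apply, Matrix.of_apply]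
          by_cases h : i = a
          · subst h; field_simp; ring
          · have his : i ∉ s := fun his => hi (Finset.mem_erase.mpr ⟨h, his⟩)
            rw [h0 i j his, h0' a i his]; simp
        · intro i hi j hj k hk l hl hik hjl hij hkl
          rw [Finset.mem_erase] at hi hj hk hl
          simp only [hR, Matrix.sub_apply, Matrix.of_apply]
          have e := hm i hi.2 j hj.2 k hk.2 l hl.2 hik hjl hij hkl
          have e1 := hm a has i hi.2 a has k hk.2 le_rfl hik hi.1.symm hk.1.symm
          have e2 := hm a has j hj.2 a has l hl.2 le_rfl hjl hj.1.symm hl.1.symm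
          have e3 := hrow k hk.2 hk.1
          have e4 := hrow l hl.2 hl.1
          have : A a k * A a l / A a a ≤ A a i * A a j / A a a := by
            apply div_le_div_of_nonneg_right _ hpos.le
            nlinarith
          linarith
        · intro x hx
          set t : ℝ := -(A.mulVec x) a / A a a with ht
          have hta : t * A a a = -(A.mulVec x) a := by rw [ht]; field_simp
          have hR2 : x ⬝ᵥ R.mulVec x = (A.mulVec x) a ^ 2 / A a a := by
            rw [quad_eq, sq]
            simp only [mulVec, dotProduct]
            rw [Finset.sum_mul_sum, Finset.sum_div]
            refine Finset.sum_congr rfl fun i _ => ?_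
            rw [Finset.sum_div]
            refine Finset.sum_congr rfl fun j _ => ?_
            simp only [hR, Matrix.of_apply]
            ring
          have hq := hcop (x + Pi.single a t) (by
            intro i
            by_cases h : i = a
            · subst h
              simp only [Pi.add_apply, Pi.single_eq_same]
              have h2 : (A.mulVec x) i ≤ A i i * x i := by
                simp only [mulVec, dotProduct]
                rw [← Finset.add_sum_erase _ _ (Finset.mem_univ i)]
                have : ∑ j ∈ Finset.univ.erase i, A i j * x j ≤ 0 := by
                  apply Finset.sum_nonpos
                  intro j hj
                  apply mul_nonpos_of_nonpos_of_nonneg _ (hx j)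
                  by_cases hjs : j ∈ s
                  · exact (hrow j hjs (Finset.ne_of_mem_erase hj)).le
                  · exact (h0' i j hjs).le
                linarith
              by_contra hlt
              push Not at hlt
              nlinarith
            · simp [Pi.single_apply, h, hx i])
          rw [quad_add_single A hs] at hq
          rw [sub_mulVec, dotProduct_sub, hR2]
          have e : (A.mulVec x) a = -(t * A a a) := by linarith
          have e2 : (A.mulVec x) a ^ 2 / A a a = t ^ 2 * A a a := by
            rw [e]; field_simp
          rw [e2]
          rw [e] at hq
          nlinarith
      have := hA'n.add' (SPN.of_psd hRp)
      simpa using this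

/-- Matrix `B` plus `d` in the diagonal position `p`: copositivity from the dehomogenized form. -/
lemma cop_of_dehom {ι : Type*} [Fintype ι] [DecidableEq ι] (B : Matrix ι ι ℝ) (p : ι)
    (h1 : ∀ x : ι → ℝ, (∀ i, 0 ≤ x i) → x p = 1 → 0 ≤ x ⬝ᵥ B.mulVec x)
    (h0 : ∀ x : ι → ℝ, (∀ i, 0 ≤ x i) → x p = 0 → 0 ≤ x ⬝ᵥ B.mulVec x) : Copositive B := by
  intro x hx
  rcases (hx p).eq_or_lt with h | h
  · exact h0 x hx h.symm
  · have := h1 ((x p)⁻¹ • x) (fun i => mul_nonneg (inv_nonneg.mpr h.le) (hx i))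
      (by simp [h.ne'])
    rw [mulVec_smul, smul_dotProduct, dotProduct_smul] at this
    simp only [smul_eq_mul] at this
    rw [← mul_assoc] at this
    exact nonneg_of_mul_nonneg_right this (by positivity)

lemma quad_single {ι : Type*} [Fintype ι] [DecidableEq ι] (B : Matrix ι ι ℝ) (p : ι) (d : ℝ)
    (x : ι → ℝ) : x ⬝ᵥ (B + Matrix.single p p d).mulVec x = x ⬝ᵥ B.mulVec x + d * x p ^ 2 := by
  rw [add_mulVec, dotProduct_add]
  congr 1
  rw [quad_eq, Finset.sum_eq_single p, Finset.sum_eq_single p]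
  · simp; ring
  · intro j _ hj; simp [Matrix.single_apply, hj.symm]
  · simp
  · intro i _ hi
    apply Finset.sum_eq_zero
    intro j _; simp [Matrix.single_apply, hi.symm]
  · simp

/-- The splitting result. -/
lemma splitting {ι : Type*} [Fintype ι] [LinearOrder ι] (A : Matrix ι ι ℝ) (p : ι)
    (hzero : ∀ i j, i < p → p < j → A i j = 0 ∧ A j i = 0) (hcop : Copositive A)
    (B1 B2 : Matrix ι ι ℝ)
    (hB1 : ∀ i j, B1 i j = if i ≤ p ∧ j ≤ p ∧ ¬ (i = p ∧ j = p) then A i j else 0)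
    (hB2 : ∀ i j, B2 i j = if p ≤ i ∧ p ≤ j ∧ ¬ (i = p ∧ j = p) then A i j else 0) :
    ∃ c1 c2 : ℝ, A = (B1 + Matrix.single p p c1) + (B2 + Matrix.single p p c2) ∧
      Copositive (B1 + Matrix.single p p c1) ∧ Copositive (B2 + Matrix.single p p c2) := by
  have hsum : A = B1 + B2 + Matrix.single p p (A p p) := by
    ext i j
    simp only [Matrix.add_apply, hB1, hB2, Matrix.single_apply]
    rcases lt_trichotomy i p with hi | hi | hi <;> rcases lt_trichotomy j p with hj | hj | hj
    · simp [hi.le, hj.le, hi.ne, hi.not_ge, hi.ne']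
    · subst hj; simp [hi.le, hi.ne, hi.not_ge, hi.ne']
    · simp [(hzero i j hi hj).1]; intro h; exact absurd h hi.ne'
    · subst hi; simp [hj.le, hj.ne, hj.not_ge, hj.ne']
    · subst hi; subst hj; simp
    · subst hi; simp [hj.le, hj.ne, hj.not_ge, hj.ne']
    · simp [(hzero j i hj hi).2]; intro h; exact absurd h hi.ne
    · subst hj; simp [hi.le, hi.ne, hi.not_ge, hi.ne']
    · simp [hi.le, hj.le, hi.ne, hi.not_ge, hi.ne']
  have hglue : ∀ x y : ι → ℝ, (∀ i, 0 ≤ x i) → (∀ i, 0 ≤ y i) → x p = y p →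
      0 ≤ x ⬝ᵥ B1.mulVec x + y ⬝ᵥ B2.mulVec y + A p p * x p ^ 2 := by
    intro x y hx hy hxy
    set w : ι → ℝ := fun i => if i ≤ p then x i else y i with hw
    have hwx : ∀ i, i ≤ p → w i = x i := fun i hi => by simp [hw, hi]
    have hwy : ∀ i, p ≤ i → w i = y i := fun i hi => by
      rcases hi.eq_or_lt with h | h
      · subst h; simp [hw, hxy]
      · simp [hw, h.not_ge]
    have h := hcop w (by intro i; simp only [hw]; split_ifs; exacts [hx i, hy i])
    have e1 : w ⬝ᵥ B1.mulVec w = x ⬝ᵥ B1.mulVec x := by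
      rw [quad_eq, quad_eq]
      refine Finset.sum_congr rfl fun i _ => Finset.sum_congr rfl fun j _ => ?_
      rw [hB1]
      split_ifs with h
      · rw [hwx i h.1, hwx j h.2.1]
      · simp
    have e2 : w ⬝ᵥ B2.mulVec w = y ⬝ᵥ B2.mulVec y := by
      rw [quad_eq, quad_eq]
      refine Finset.sum_congr rfl fun i _ => Finset.sum_congr rfl fun j _ => ?_
      rw [hB2]
      split_ifs with h
      · rw [hwy i h.1, hwy j h.2.1]
      · simp
    rw [hsum, quad_single, add_mulVec, dotProduct_add, e1, e2, hwx p le_rfl] at h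
    exact h
  have hone : ∀ i, 0 ≤ (Pi.single p 1 : ι → ℝ) i := by
    intro i; rw [Pi.single_apply]; split_ifs <;> norm_num
  set S : Set ℝ := {r | ∃ x : ι → ℝ, (∀ i, 0 ≤ x i) ∧ x p = 1 ∧ r = -(x ⬝ᵥ B1.mulVec x)} with hS
  have hSne : S.Nonempty := ⟨_, Pi.single p 1, hone, by simp, rfl⟩
  have hub : ∀ y : ι → ℝ, (∀ i, 0 ≤ y i) → y p = 1 → ∀ r ∈ S, r ≤ y ⬝ᵥ B2.mulVec y + A p p := by
    rintro y hy hyp r ⟨x, hx, hxp, rfl⟩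
    have := hglue x y hx hy (hxp.trans hyp.symm)
    rw [hxp] at this
    linarith
  have hbdd : BddAbove S := ⟨_, fun r hr => hub (Pi.single p 1) hone (by simp) r hr⟩
  refine ⟨sSup S, A p p - sSup S, ?_, ?_, ?_⟩
  · conv_lhs => rw [hsum]
    have : Matrix.single p p (A p p)
        = Matrix.single p p (sSup S) + Matrix.single p p (A p p - sSup S) := by
      rw [← Matrix.single_add]; congr 1; ring
    rw [this]
    abel
  · apply cop_of_dehom _ p
    · intro x hx hxp
      rw [quad_single, hxp]
      have := le_csSup hbdd (show -(x ⬝ᵥ B1.mulVec x) ∈ S from ⟨x, hx, hxp, rfl⟩)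
      linarith
    · intro x hx hxp
      rw [quad_single, hxp]
      have := hglue x 0 hx (by simp) (by simp [hxp])
      simpa [hxp] using this
  · apply cop_of_dehom _ p
    · intro y hy hyp
      rw [quad_single, hyp]
      have := csSup_le hSne (hub y hy hyp)
      linarith
    · intro y hy hyp
      rw [quad_single, hyp]
      have := hglue 0 y (by simp) hy (by simp [hyp])
      simpa [hyp] using this

theorem stmt_14 {n k : ℕ} (A : Matrix (Fin (n + 1 + k)) (Fin (n + 1 + k)) ℝ)
    (hA : A.IsSymm)
    (f : Fin (n + 1) → Fin (n + 1 + k)) (hf : ∀ i : Fin (n + 1), (f i : ℕ) = (i : ℕ))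
    (g : Fin (k + 1) → Fin (n + 1 + k)) (hg : ∀ i : Fin (k + 1), (g i : ℕ) = n + (i : ℕ))
    (hzero : ∀ i j : Fin (n + 1 + k), (i : ℕ) < n → n < (j : ℕ) → A i j = 0 ∧ A j i = 0)
    (hB1 : Mn (A.submatrix f f))
    (hB2 : Mn (A.submatrix g g))
    (hcop : Copositive A) :
    SPN A := by
  have hsym : ∀ i j, A i j = A j i := fun i j => hA.apply j i
  obtain ⟨p, hp⟩ : ∃ p : Fin (n + 1 + k), (p : ℕ) = n := ⟨⟨n, by omega⟩, rfl⟩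
  obtain ⟨c1, c2, hsum, hc1, hc2⟩ := splitting A p
    (fun i j hi hj => hzero i j (lt_of_lt_of_eq (Fin.lt_def.mp hi) hp)
      (lt_of_eq_of_lt hp.symm (Fin.lt_def.mp hj))) hcop
    (Matrix.of fun i j => if i ≤ p ∧ j ≤ p ∧ ¬ (i = p ∧ j = p) then A i j else 0)
    (Matrix.of fun i j => if p ≤ i ∧ p ≤ j ∧ ¬ (i = p ∧ j = p) then A i j else 0)
    (fun _ _ => rfl) (fun _ _ => rfl)
  have hfs : ∀ i, i ≤ p → ∃ i', f i' = i := fun i hi =>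
    ⟨⟨i, by have : (i : ℕ) ≤ p := hi
            omega⟩, Fin.ext (by rw [hf])⟩
  have hgs : ∀ i, p ≤ i → ∃ i', g i' = i := fun i hi =>
    ⟨⟨i - n, by omega⟩, Fin.ext (by
      rw [hg]
      have : (p : ℕ) ≤ i := hi
      simp only
      omega)⟩
  have hfle : ∀ i j, f i ≤ f j → i ≤ j := fun i j h => by
    rw [Fin.le_def, hf, hf] at h; exact h
  have hgle : ∀ i j, g i ≤ g j → i ≤ j := fun i j h => by
    rw [Fin.le_def, hg, hg] at h; rw [Fin.le_def]; omega
  have hoff : ∀ (i j : Fin (n + 1 + k)) (c : ℝ), i ≠ j → Matrix.single p p c i j = 0 := by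
    intro i j c hij
    rw [Matrix.single_apply, if_neg]
    rintro ⟨h1, h2⟩
    exact hij (h1.symm.trans h2)
  rw [hsum]
  apply SPN.add'
  · refine main_aux _ (Finset.univ.filter (· ≤ p)) _ rfl ?_ ?_ ?_ hc1
    · ext i j
      simp only [Matrix.transpose_apply, Matrix.add_apply, Matrix.of_apply, Matrix.single_apply,
        hsym j i]
      congr 1
      · exact if_congr (by tauto) rfl rfl
      · exact if_congr (by tauto) rfl rfl
    · intro i j hi
      simp only [Finset.mem_filter, Finset.mem_univ, true_and] at hi
      have : p ≠ i := fun h => hi h.ge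
      simp [Matrix.single_apply, hi, this]
    · intro i hi j hj a ha b hb hia hjb hij hab
      simp only [Finset.mem_filter, Finset.mem_univ, true_and] at hi hj ha hb
      rw [Matrix.add_apply, Matrix.add_apply, hoff i j _ hij, hoff a b _ hab, Matrix.of_apply,
        Matrix.of_apply, if_pos ⟨hi, hj, fun h => hij (h.1.trans h.2.symm)⟩,
        if_pos ⟨ha, hb, fun h => hab (h.1.trans h.2.symm)⟩, add_zero, add_zero]
      obtain ⟨i, rfl⟩ := hfs i hi
      obtain ⟨j, rfl⟩ := hfs j hj
      obtain ⟨a, rfl⟩ := hfs a ha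
      obtain ⟨b, rfl⟩ := hfs b hb
      exact hB1 i j a b (hfle _ _ hia) (hfle _ _ hjb) (fun h => hij (h ▸ rfl))
        (fun h => hab (h ▸ rfl))
  · refine main_aux _ (Finset.univ.filter (p ≤ ·)) _ rfl ?_ ?_ ?_ hc2
    · ext i j
      simp only [Matrix.transpose_apply, Matrix.add_apply, Matrix.of_apply, Matrix.single_apply,
        hsym j i]
      congr 1
      · exact if_congr (by tauto) rfl rfl
      · exact if_congr (by tauto) rfl rfl
    · intro i j hi
      simp only [Finset.mem_filter, Finset.mem_univ, true_and] at hi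
      have : p ≠ i := fun h => hi h.le
      simp [Matrix.single_apply, hi, this]
    · intro i hi j hj a ha b hb hia hjb hij hab
      simp only [Finset.mem_filter, Finset.mem_univ, true_and] at hi hj ha hb
      rw [Matrix.add_apply, Matrix.add_apply, hoff i j _ hij, hoff a b _ hab, Matrix.of_apply,
        Matrix.of_apply, if_pos ⟨hi, hj, fun h => hij (h.1.trans h.2.symm)⟩,
        if_pos ⟨ha, hb, fun h => hab (h.1.trans h.2.symm)⟩, add_zero, add_zero]
      obtain ⟨i, rfl⟩ := hgs i hi
      obtain ⟨j, rfl⟩ := hgs j hj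
      obtain ⟨a, rfl⟩ := hgs a ha
      obtain ⟨b, rfl⟩ := hgs b hb
      exact hB2 i j a b (hgle _ _ hia) (hgle _ _ hjb) (fun h => hij (h ▸ rfl))
        (fun h => hab (h ▸ rfl))
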